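/- arXiv:1612.00597 — 3 statements merged into one kernel-verified Lean document; each statement's English description precedes it below -/
import Mathlib

section
/- Let f(z) = Σ_{n=0}^∞ a_n z^n be analytic in the open unit disk 𝔻 with Re f(z) > 0 for all z ∈ 𝔻 (i.e., f maps 𝔻 into the right half-plane ℍ). Then Σ_{n=1}^∞ |a_n| |z|^n ≤ Re a_0 = dist(a_0, ∂ℍ) for all z with |z| ≤ 1/3. -/
/-- Orthogonality of the exponentials over one period. -/
theorem integral_exp_int_mul_I (k : ℤ) :
    ∫ θ in (0 : ℝ)..2 * Real.pi, Complex.exp (k * θ * Complex.I) =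
      if k = 0 then 2 * (Real.pi : ℂ) else 0 := by
  split_ifs with hk
  · simp [hk]
  · have hc : (k : ℂ) * Complex.I ≠ 0 := by simp [hk]
    have h := integral_exp_mul_complex (a := 0) (b := 2 * Real.pi) hc
    have e : Complex.exp (k * Complex.I * ((2 * Real.pi : ℝ) : ℂ)) = 1 := by
      rw [← Complex.exp_int_mul_two_pi_mul_I k]
      congr 1
      push_cast
      ring
    rw [e] at h
    simp only [Complex.ofReal_zero, mul_zero, Complex.exp_zero, sub_self, zero_div] at h
    rw [← h]
    congr 1
    ext θ
    congr 1
    ring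

/-- A power series convergent on the open unit disk converges absolutely at each radius
`r < 1`. -/
theorem summable_norm_mul_pow_of_hasSum {f : ℂ → ℂ} {a : ℕ → ℂ}
    (hrep : ∀ z : ℂ, ‖z‖ < 1 → HasSum (fun n : ℕ => a n * z ^ n) (f z))
    {r : ℝ} (hr0 : 0 ≤ r) (hr1 : r < 1) : Summable fun n => ‖a n‖ * r ^ n := by
  have h := (hrep r (by simpa [abs_of_nonneg hr0] using hr1)).summable.norm
  simpa [abs_of_nonneg hr0] using h

theorem norm_ofReal_mul_exp_mul_I {r : ℝ} (hr0 : 0 ≤ r) (θ : ℝ) :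
    ‖(r : ℂ) * Complex.exp (θ * Complex.I)‖ = r := by
  simp [Complex.norm_exp_ofReal_mul_I, abs_of_nonneg hr0]

theorem continuous_circle_of_hasSum {f : ℂ → ℂ} {a : ℕ → ℂ}
    (hrep : ∀ z : ℂ, ‖z‖ < 1 → HasSum (fun n : ℕ => a n * z ^ n) (f z))
    {r : ℝ} (hr0 : 0 ≤ r) (hr1 : r < 1) :
    Continuous fun θ : ℝ => f (r * Complex.exp (θ * Complex.I)) := by
  have e : (fun θ : ℝ => f (r * Complex.exp (θ * Complex.I))) =
      fun θ : ℝ => ∑' n, a n * (r * Complex.exp (θ * Complex.I)) ^ n := by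
    ext θ
    exact (hrep _ (by rwa [norm_ofReal_mul_exp_mul_I hr0])).tsum_eq.symm
  rw [e]
  refine continuous_tsum (fun n => by fun_prop)
    (summable_norm_mul_pow_of_hasSum hrep hr0 hr1) fun n θ => ?_
  rw [norm_mul, norm_pow, norm_ofReal_mul_exp_mul_I hr0]

/-- The Fourier coefficients of a power series on a circle, as a termwise sum. -/
theorem hasSum_integral_circle {f : ℂ → ℂ} {a : ℕ → ℂ}
    (hrep : ∀ z : ℂ, ‖z‖ < 1 → HasSum (fun n : ℕ => a n * z ^ n) (f z))
    {r : ℝ} (hr0 : 0 ≤ r) (hr1 : r < 1) (k : ℤ) :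
    HasSum (fun m : ℕ => a m * r ^ m * if (m : ℤ) + k = 0 then 2 * (Real.pi : ℂ) else 0)
      (∫ θ in (0 : ℝ)..2 * Real.pi,
        f (r * Complex.exp (θ * Complex.I)) * Complex.exp (k * θ * Complex.I)) := by
  have h := intervalIntegral.hasSum_integral_of_dominated_convergence
    (μ := MeasureTheory.volume) (a := 0) (b := 2 * Real.pi)
    (F := fun (m : ℕ) (θ : ℝ) =>
      a m * (r * Complex.exp (θ * Complex.I)) ^ m * Complex.exp (k * θ * Complex.I))
    (f := fun θ : ℝ =>
      f (r * Complex.exp (θ * Complex.I)) * Complex.exp (k * θ * Complex.I))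
    (fun m _ => ‖a m‖ * r ^ m)
    (fun m => Continuous.aestronglyMeasurable (by fun_prop))
    (fun m => Filter.Eventually.of_forall fun θ _ => ?_)
    (Filter.Eventually.of_forall fun θ _ =>
      summable_norm_mul_pow_of_hasSum hrep hr0 hr1)
    intervalIntegrable_const
    (Filter.Eventually.of_forall fun θ _ =>
      (hrep _ (by rwa [norm_ofReal_mul_exp_mul_I hr0])).mul_right _)
  · refine (congrArg (HasSum · _) (funext fun m => ?_)).mpr h
    rw [← integral_exp_int_mul_I, ← intervalIntegral.integral_const_mul]
    congr 1
    ext θ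
    have e : Complex.exp (((m : ℤ) + k : ℤ) * θ * Complex.I) =
        Complex.exp (m * (θ * Complex.I)) * Complex.exp (k * θ * Complex.I) := by
      rw [← Complex.exp_add]
      congr 1
      push_cast
      ring
    rw [e, mul_pow, ← Complex.exp_nat_mul]
    ring
  · have e : ‖Complex.exp (k * θ * Complex.I)‖ = 1 := by
      simpa using Complex.norm_exp_ofReal_mul_I (k * θ)
    rw [norm_mul, norm_mul, norm_pow, norm_ofReal_mul_exp_mul_I hr0, e, mul_one]

theorem integral_circle_mul_exp_neg {f : ℂ → ℂ} {a : ℕ → ℂ}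
    (hrep : ∀ z : ℂ, ‖z‖ < 1 → HasSum (fun n : ℕ => a n * z ^ n) (f z))
    {r : ℝ} (hr0 : 0 ≤ r) (hr1 : r < 1) (n : ℕ) :
    ∫ θ in (0 : ℝ)..2 * Real.pi,
      f (r * Complex.exp (θ * Complex.I)) * Complex.exp ((-n : ℤ) * θ * Complex.I) =
        2 * Real.pi * (a n * r ^ n) := by
  refine (hasSum_integral_circle hrep hr0 hr1 (-n)).unique ?_
  convert hasSum_single n ?_ using 1
  · simp [mul_comm]
  · intro m hm
    rw [if_neg (by lia), mul_zero]

theorem integral_circle_mul_exp_of_pos {f : ℂ → ℂ} {a : ℕ → ℂ}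
    (hrep : ∀ z : ℂ, ‖z‖ < 1 → HasSum (fun n : ℕ => a n * z ^ n) (f z))
    {r : ℝ} (hr0 : 0 ≤ r) (hr1 : r < 1) {n : ℕ} (hn : 0 < n) :
    ∫ θ in (0 : ℝ)..2 * Real.pi,
      f (r * Complex.exp (θ * Complex.I)) * Complex.exp ((n : ℤ) * θ * Complex.I) = 0 := by
  refine (hasSum_integral_circle hrep hr0 hr1 n).unique ?_
  convert hasSum_zero using 2 with m
  rw [if_neg (by lia), mul_zero]

/-- Carathéodory's coefficient estimate on a circle of radius `r < 1`. -/
theorem norm_coeff_mul_pow_le_of_re_pos {f : ℂ → ℂ} {a : ℕ → ℂ}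
    (hrep : ∀ z : ℂ, ‖z‖ < 1 → HasSum (fun n : ℕ => a n * z ^ n) (f z))
    (hre : ∀ z : ℂ, ‖z‖ < 1 → 0 < (f z).re)
    {r : ℝ} (hr0 : 0 ≤ r) (hr1 : r < 1) {n : ℕ} (hn : 0 < n) :
    ‖a n‖ * r ^ n ≤ 2 * (a 0).re := by
  set F : ℝ → ℂ := fun θ => f (r * Complex.exp (θ * Complex.I)) with hF
  have hFc : Continuous F := continuous_circle_of_hasSum hrep hr0 hr1
  have h0 : ∫ θ in (0 : ℝ)..2 * Real.pi, F θ = 2 * Real.pi * a 0 := by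
    simpa using integral_circle_mul_exp_neg hrep hr0 hr1 0
  have h0re : ∫ θ in (0 : ℝ)..2 * Real.pi, (F θ).re = 2 * Real.pi * (a 0).re := by
    have h := Complex.reCLM.intervalIntegral_comp_comm
      (hFc.intervalIntegrable (μ := MeasureTheory.volume) 0 (2 * Real.pi))
    rw [h0] at h
    simpa using h
  have hneg := integral_circle_mul_exp_neg hrep hr0 hr1 n
  have hconj : ∫ θ in (0 : ℝ)..2 * Real.pi,
      (starRingEnd ℂ) (F θ) * Complex.exp ((-n : ℤ) * θ * Complex.I) = 0 := by
    have h := congrArg (starRingEnd ℂ) (integral_circle_mul_exp_of_pos hrep hr0 hr1 hn)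
    rw [map_zero, ← intervalIntegral.intervalIntegral_conj] at h
    rw [← h]
    congr 1
    ext θ
    simp [hF, ← Complex.exp_conj]
  have hsum : ∫ θ in (0 : ℝ)..2 * Real.pi,
      (2 * (F θ).re : ℂ) * Complex.exp ((-n : ℤ) * θ * Complex.I) =
        2 * Real.pi * (a n * r ^ n) := by
    rw [← add_zero (2 * Real.pi * (a n * r ^ n)), ← hneg, ← hconj,
      ← intervalIntegral.integral_add]
    · congr 1
      ext θ
      rw [← add_mul, Complex.add_conj]
      push_cast
      rfl
    · exact (hFc.mul (by fun_prop)).intervalIntegrable _ _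
    · exact ((Complex.continuous_conj.comp hFc).mul (by fun_prop)).intervalIntegrable _ _
  have hle := intervalIntegral.norm_integral_le_integral_norm (μ := MeasureTheory.volume)
    (f := fun θ : ℝ => (2 * (F θ).re : ℂ) * Complex.exp ((-n : ℤ) * θ * Complex.I))
    Real.two_pi_pos.le
  have hnorm : ∀ θ : ℝ,
      ‖(2 * (F θ).re : ℂ) * Complex.exp ((-n : ℤ) * θ * Complex.I)‖ = 2 * (F θ).re := by
    intro θ
    have e : ‖Complex.exp ((-n : ℤ) * θ * Complex.I)‖ = 1 := by
      simpa using Complex.norm_exp_ofReal_mul_I ((-n : ℤ) * θ)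
    have hpos : 0 < (F θ).re := hre _ (by rwa [norm_ofReal_mul_exp_mul_I hr0])
    rw [norm_mul, e, mul_one, norm_mul, Complex.norm_real, Real.norm_of_nonneg hpos.le]
    simp
  simp only [hnorm] at hle
  rw [hsum, intervalIntegral.integral_const_mul, h0re] at hle
  simp only [norm_mul, norm_pow, Complex.norm_real, Real.norm_of_nonneg hr0,
    Real.norm_of_nonneg Real.pi_pos.le, Complex.norm_ofNat] at hle
  refine le_of_mul_le_mul_left ?_ Real.two_pi_pos
  linarith

/-- Carathéodory's coefficient estimate for power series with positive real part. -/
theorem norm_coeff_le_two_mul_re_of_re_pos {f : ℂ → ℂ} {a : ℕ → ℂ}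
    (hrep : ∀ z : ℂ, ‖z‖ < 1 → HasSum (fun n : ℕ => a n * z ^ n) (f z))
    (hre : ∀ z : ℂ, ‖z‖ < 1 → 0 < (f z).re) {n : ℕ} (hn : 0 < n) :
    ‖a n‖ ≤ 2 * (a 0).re := by
  have hc : Continuous fun r : ℝ => ‖a n‖ * r ^ n := by fun_prop
  have ht : Filter.Tendsto (fun r : ℝ => ‖a n‖ * r ^ n) (nhdsWithin 1 (Set.Iio 1))
      (nhds ‖a n‖) := by
    simpa using (hc.tendsto 1).mono_left nhdsWithin_le_nhds
  refine le_of_tendsto ht ?_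
  filter_upwards [Ioo_mem_nhdsLT (zero_lt_one' ℝ)] with r hr
  exact norm_coeff_mul_pow_le_of_re_pos hrep hre hr.1.le hr.2 hn


/-- Bohr phenomenon for maps into the right half-plane: if `f z = ∑ aₙ zⁿ` is
analytic in the unit disk with `Re f > 0` there, then
`∑_{n≥1} |aₙ| |z|ⁿ ≤ Re a₀ (= dist(a₀, ∂ℍ))` for `|z| ≤ 1/3`. -/
theorem bohr_right_half_plane
    (f : ℂ → ℂ) (a : ℕ → ℂ)
    (hrep : ∀ z : ℂ, ‖z‖ < 1 → HasSum (fun n : ℕ => a n * z ^ n) (f z))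
    (hre : ∀ z : ℂ, ‖z‖ < 1 → 0 < (f z).re) :
    ∀ z : ℂ, ‖z‖ ≤ 1 / 3 →
      ∑' n : ℕ, ‖a (n + 1)‖ * ‖z‖ ^ (n + 1) ≤ (a 0).re := by
  intro z hz
  have hA : 0 ≤ 2 * (a 0).re := (norm_nonneg _).trans
    (norm_coeff_le_two_mul_re_of_re_pos hrep hre one_pos)
  have hb : ∀ n : ℕ, ‖a (n + 1)‖ * ‖z‖ ^ (n + 1) ≤ 2 * (a 0).re * (1 / 3) * (1 / 3) ^ n := by
    intro n
    rw [mul_assoc, ← pow_succ']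
    exact mul_le_mul (norm_coeff_le_two_mul_re_of_re_pos hrep hre n.succ_pos)
      (pow_le_pow_left₀ (norm_nonneg z) hz _) (by positivity) hA
  have hg : HasSum (fun n : ℕ => 2 * (a 0).re * (1 / 3) * (1 / 3 : ℝ) ^ n) (a 0).re := by
    have h := (hasSum_geometric_of_lt_one (r := (1 / 3 : ℝ)) (by norm_num)
      (by norm_num)).mul_left (2 * (a 0).re * (1 / 3))
    rwa [show 2 * (a 0).re * (1 / 3) * (1 - 1 / 3 : ℝ)⁻¹ = (a 0).re by ring] at h
  exact hasSum_le hb (hg.summable.of_nonneg_of_le (fun n => by positivity) hb).hasSum hg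
end

section
/- Let g(z) = Σ_{n=0}^∞ b_n z^n be analytic in the open unit disk 𝔻 with values in the slit plane ℙ = ℂ ∖ (−∞, 0] (i.e., g(z) is never a real number ≤ 0). Then Σ_{n=1}^∞ |b_n| |z|^n ≤ |b_0| for all z with |z| ≤ 3 − 2√2, where |b_0| equals the Euclidean distance dist(|b_0|, ∂ℙ) from the point |b_0| to the boundary (−∞, 0] of ℙ. -/
open Metric Filter Topology

theorem hasFPowerSeriesOnBall_ofScalars_of_hasSum {f : ℂ → ℂ} {c : ℕ → ℂ}
    (hf : ∀ z : ℂ, ‖z‖ < 1 → HasSum (fun n : ℕ => c n * z ^ n) (f z)) :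
    HasFPowerSeriesOnBall f (FormalMultilinearSeries.ofScalars ℂ c) 0 1 where
  r_le := by
    refine ENNReal.le_of_forall_nnreal_lt fun r hr => ?_
    have hr' : (r : ℝ) < 1 := by exact_mod_cast hr
    have h := (hf (r : ℂ) (by simpa using hr')).summable.tendsto_atTop_zero.norm
    refine FormalMultilinearSeries.le_radius_of_tendsto _ (l := 0) ?_
    simpa [FormalMultilinearSeries.ofScalars_norm] using h
  r_pos := one_pos
  hasSum := by
    intro y hy
    have hy' : ‖y‖ < 1 := by simpa [← ofReal_norm] using hy
    simpa [FormalMultilinearSeries.ofScalars_apply_eq, mul_comm] using hf y hy'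

theorem differentiableOn_unitBall_of_hasSum {f : ℂ → ℂ} {c : ℕ → ℂ}
    (hf : ∀ z : ℂ, ‖z‖ < 1 → HasSum (fun n : ℕ => c n * z ^ n) (f z)) :
    DifferentiableOn ℂ f (ball 0 1) := by
  have h := (hasFPowerSeriesOnBall_ofScalars_of_hasSum hf).differentiableOn
  have e := eball_coe (x := (0 : ℂ)) (ε := 1)
  rw [ENNReal.coe_one] at e
  simpa [e] using h

theorem coeff_eq_of_hasFPowerSeriesAt {f : ℂ → ℂ} {c : ℕ → ℂ}
    (hf : ∀ z : ℂ, ‖z‖ < 1 → HasSum (fun n : ℕ => c n * z ^ n) (f z))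
    {p : FormalMultilinearSeries ℂ ℂ ℂ} (hp : HasFPowerSeriesAt f p 0) (n : ℕ) :
    c n = p.coeff n := by
  have h := (hasFPowerSeriesOnBall_ofScalars_of_hasSum hf).hasFPowerSeriesAt
  rw [← h.eq_formalMultilinearSeries hp, FormalMultilinearSeries.coeff_ofScalars]

theorem coeff_eq_circleAverage {f : ℂ → ℂ} {c : ℕ → ℂ}
    (hf : ∀ z : ℂ, ‖z‖ < 1 → HasSum (fun n : ℕ => c n * z ^ n) (f z))
    {R : ℝ} (hR0 : 0 < R) (hR1 : R < 1) (n : ℕ) :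
    c n = Real.circleAverage (fun z => z⁻¹ ^ n * f z) 0 R := by
  lift R to NNReal using hR0.le
  have hd : DifferentiableOn ℂ f (closedBall 0 R) :=
    (differentiableOn_unitBall_of_hasSum hf).mono (closedBall_subset_ball hR1)
  have hp := (hd.hasFPowerSeriesOnBall (by exact_mod_cast hR0)).hasFPowerSeriesAt
  rw [coeff_eq_of_hasFPowerSeriesAt hf hp n, Real.circleAverage_eq_circleIntegral hR0.ne']
  simp only [FormalMultilinearSeries.coeff, cauchyPowerSeries]
  simp [mul_left_comm]

/-- **Carathéodory's coefficient bound** for functions with nonnegative real part. -/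
theorem norm_coeff_le_two_mul_re {f : ℂ → ℂ} {c : ℕ → ℂ}
    (hf : ∀ z : ℂ, ‖z‖ < 1 → HasSum (fun n : ℕ => c n * z ^ n) (f z))
    (hre : ∀ z : ℂ, ‖z‖ < 1 → 0 ≤ (f z).re) {n : ℕ} (hn : n ≠ 0) :
    ‖c n‖ ≤ 2 * (c 0).re := by
  have hd := differentiableOn_unitBall_of_hasSum hf
  have key : ∀ R : ℝ, 0 < R → R < 1 → ‖c n‖ * R ^ n ≤ 2 * (c 0).re := by
    intro R hR0 hR1
    have hmem : ∀ z ∈ sphere (0 : ℂ) |R|, z ≠ 0 ∧ ‖z‖ = R := by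
      intro z hz
      have : ‖z‖ = R := by simpa [abs_of_pos hR0] using hz
      exact ⟨norm_pos_iff.1 (this ▸ hR0), this⟩
    have hcont : ContinuousOn f (sphere 0 |R|) :=
      hd.continuousOn.mono fun z hz => by simp [(hmem z hz).2, hR1]
    have hinv : ContinuousOn (fun z : ℂ => z⁻¹ ^ n) (sphere 0 |R|) :=
      (continuousOn_inv₀.mono fun z hz => (hmem z hz).1).pow n
    have hconj : ContinuousOn (fun z => star (f z)) (sphere 0 |R|) := hcont.star
    have hzero : Real.circleAverage (fun z => z ^ n * f z) 0 R = 0 := by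
      have : DiffContOnCl ℂ (fun z => z ^ n * f z) (ball 0 |R|) := by
        refine DifferentiableOn.diffContOnCl ((DifferentiableOn.pow differentiableOn_id n).mul
          (hd.mono ?_))
        rw [abs_of_pos hR0]
        exact closure_ball_subset_closedBall.trans (closedBall_subset_ball hR1)
      rw [this.circleAverage]
      simp [hn]
    have hzero' : Real.circleAverage (fun z => z⁻¹ ^ n * star (f z)) 0 R = 0 := by
      have hci : CircleIntegrable (fun z => z ^ n * f z) 0 R :=
        ((continuousOn_pow n).mul hcont).circleIntegrable'
      have h1 := Complex.conjCLE.toContinuousLinearMap.circleAverage_comp_comm hci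
      rw [hzero, map_zero] at h1
      have h2 : Real.circleAverage (fun z => ((R : ℂ) ^ 2) ^ n * (z⁻¹ ^ n * star (f z))) 0 R
          = 0 := by
        refine (Real.circleAverage_congr_sphere fun z hz => ?_).trans h1
        obtain ⟨hz0, hzR⟩ := hmem z hz
        have : star z = (R : ℂ) ^ 2 * z⁻¹ := by
          rw [eq_mul_inv_iff_mul_eq₀ hz0, ← hzR]
          simpa using Complex.conj_mul' z
        simp only [Function.comp, ContinuousLinearEquiv.coe_coe, Complex.conjCLE_apply, map_mul,
          map_pow]
        change _ = (star z) ^ n * star (f z)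
        rw [this]
        ring
      have h3 := Real.circleAverage_fun_smul (c := 0) (R := R) (a := ((R : ℂ) ^ 2) ^ n)
        (f := fun z : ℂ => z⁻¹ ^ n * star (f z))
      simp only [smul_eq_mul] at h3
      rw [h3] at h2
      exact (mul_eq_zero.1 h2).resolve_left
        (pow_ne_zero _ (pow_ne_zero _ (Complex.ofReal_ne_zero.2 hR0.ne')))
    have hsum : c n = Real.circleAverage (fun z => z⁻¹ ^ n * ((2 * (f z).re : ℝ) : ℂ)) 0 R := by
      have hadd := Real.circleAverage_fun_add (f₁ := fun z => z⁻¹ ^ n * f z)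
        (f₂ := fun z => z⁻¹ ^ n * star (f z)) (hinv.mul hcont).circleIntegrable'
        (hinv.mul hconj).circleIntegrable'
      rw [hzero', add_zero, ← coeff_eq_circleAverage hf hR0 hR1 n] at hadd
      rw [← hadd]
      congr 1
      ext z : 1
      rw [← mul_add]
      congr 1
      simpa using Complex.add_conj (f z)
    have hre0 : (c 0).re = Real.circleAverage (fun z => (f z).re) 0 R := by
      have h1 := Complex.reCLM.circleAverage_comp_comm hcont.circleIntegrable'
      have h2 := coeff_eq_circleAverage hf hR0 hR1 0
      simp only [pow_zero, one_mul] at h2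
      rw [h2]
      exact h1.symm
    have hle : ‖c n‖ ≤ Real.circleAverage (fun z => (2 * (R ^ n)⁻¹) • (f z).re) 0 R := by
      rw [hsum, Real.circleAverage, Real.circleAverage, norm_smul, smul_eq_mul, Real.norm_of_nonneg
        (by positivity)]
      refine mul_le_mul_of_nonneg_left ?_ (by positivity)
      refine (intervalIntegral.norm_integral_le_integral_norm (by positivity)).trans_eq ?_
      refine intervalIntegral.integral_congr fun θ _ => ?_
      have hz := hmem _ (circleMap_mem_sphere' 0 R θ)
      have := hre (circleMap 0 R θ) (by rwa [hz.2])
      simp only [norm_mul, norm_pow, norm_inv, hz.2, Complex.norm_real, Real.norm_eq_abs,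
        abs_of_nonneg this, smul_eq_mul, abs_two]
      rw [inv_pow]; ring
    rw [Real.circleAverage_fun_smul, ← hre0, smul_eq_mul] at hle
    calc ‖c n‖ * R ^ n ≤ 2 * (R ^ n)⁻¹ * (c 0).re * R ^ n := by gcongr
      _ = 2 * (c 0).re := by field_simp
  have hlim : Tendsto (fun R : ℝ => ‖c n‖ * R ^ n) (𝓝[<] 1) (𝓝 (‖c n‖ * 1 ^ n)) :=
    ((continuous_const.mul (continuous_pow n)).tendsto 1).mono_left nhdsWithin_le_nhds
  rw [one_pow, mul_one] at hlim
  refine le_of_tendsto hlim ?_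
  filter_upwards [Ioo_mem_nhdsLT (zero_lt_one (α := ℝ))] with R hR using key R hR.1 hR.2

theorem exists_sq_eq_of_mem_slitPlane {g : ℂ → ℂ} {s : Set ℂ} (hg : DifferentiableOn ℂ g s)
    (hs : ∀ z ∈ s, g z ∈ Complex.slitPlane) :
    ∃ h : ℂ → ℂ, DifferentiableOn ℂ h s ∧ (∀ z ∈ s, h z ^ 2 = g z) ∧ ∀ z ∈ s, 0 < (h z).re := by
  refine ⟨fun z => Complex.exp (Complex.log (g z) / 2), ((hg.clog hs).div_const 2).cexp,
    fun z hz => ?_, fun z hz => ?_⟩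
  · rw [← Complex.exp_nat_mul, Nat.cast_two, mul_div_cancel₀ _ two_ne_zero,
      Complex.exp_log (Complex.slitPlane_ne_zero (hs z hz))]
  · rw [Complex.exp_re]
    refine mul_pos (Real.exp_pos _) (Real.cos_pos_of_mem_Ioo ?_)
    have h1 := Complex.neg_pi_lt_arg (g z)
    have h2 := (Complex.arg_le_pi (g z)).lt_of_ne (Complex.mem_slitPlane_iff_arg.1 (hs z hz)).1
    have h3 : (Complex.log (g z) / 2).im = (g z).arg / 2 := by simp [Complex.log_im]
    rw [h3]
    constructor <;> linarith

theorem exists_hasSum_of_differentiableOn_unitBall {h : ℂ → ℂ}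
    (hh : DifferentiableOn ℂ h (ball 0 1)) :
    ∃ c : ℕ → ℂ, ∀ z : ℂ, ‖z‖ < 1 → HasSum (fun n : ℕ => c n * z ^ n) (h z) := by
  refine ⟨fun n => (n.factorial : ℂ)⁻¹ * iteratedDeriv n h 0, fun z hz => ?_⟩
  have := Complex.hasSum_taylorSeries_on_ball (r := 1) (c := 0) (f := h) (by simpa using hh)
    (z := z) (by simpa using hz)
  simpa only [sub_zero, smul_eq_mul, mul_assoc, mul_comm, mul_left_comm] using this

theorem coeff_sq {g h : ℂ → ℂ} {b c : ℕ → ℂ}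
    (hg : ∀ z : ℂ, ‖z‖ < 1 → HasSum (fun n : ℕ => b n * z ^ n) (g z))
    (hh : ∀ z : ℂ, ‖z‖ < 1 → HasSum (fun n : ℕ => c n * z ^ n) (h z))
    (hsq : ∀ z : ℂ, ‖z‖ < 1 → h z ^ 2 = g z) (n : ℕ) :
    b n = ∑ p ∈ Finset.HasAntidiagonal.antidiagonal n, c p.1 * c p.2 := by
  have hg' : ∀ z : ℂ, ‖z‖ < 1 →
      HasSum (fun n : ℕ => (∑ p ∈ Finset.HasAntidiagonal.antidiagonal n, c p.1 * c p.2) * z ^ n) (g z) := by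
    intro z hz
    have hs : Summable fun n => ‖c n * z ^ n‖ := (hh z hz).summable.norm
    have h1 := summable_norm_sum_mul_antidiagonal_of_summable_norm hs hs
    have h2 := tsum_mul_tsum_eq_tsum_sum_antidiagonal_of_summable_norm hs hs
    have h3 := h1.of_norm.hasSum
    rw [← h2, (hh z hz).tsum_eq, ← sq, hsq z hz] at h3
    refine h3.congr_fun fun n => ?_
    rw [Finset.sum_mul]
    refine Finset.sum_congr rfl fun p hp => ?_
    rw [← Finset.HasAntidiagonal.mem_antidiagonal.1 hp, pow_add]
    ring
  have := coeff_eq_of_hasFPowerSeriesAt hg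
    (hasFPowerSeriesOnBall_ofScalars_of_hasSum hg').hasFPowerSeriesAt n
  rwa [FormalMultilinearSeries.coeff_ofScalars] at this

/-- Coefficients of a holomorphic map from the unit disk into the slit plane. -/
theorem norm_coeff_le_of_mem_slitPlane {g : ℂ → ℂ} {b : ℕ → ℂ}
    (hg : ∀ z : ℂ, ‖z‖ < 1 → HasSum (fun n : ℕ => b n * z ^ n) (g z))
    (hs : ∀ z : ℂ, ‖z‖ < 1 → g z ∈ Complex.slitPlane) {n : ℕ} (hn : n ≠ 0) :
    ‖b n‖ ≤ 4 * n * ‖b 0‖ := by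
  obtain ⟨h, hd, hsq, hre⟩ := exists_sq_eq_of_mem_slitPlane
    (differentiableOn_unitBall_of_hasSum hg) fun z hz => hs z (by simpa using hz)
  obtain ⟨c, hc⟩ := exists_hasSum_of_differentiableOn_unitBall hd
  have hb := coeff_sq hg hc fun z hz => hsq z (by simpa using hz)
  have hb0 : ‖b 0‖ = ‖c 0‖ ^ 2 := by simp [hb 0, sq]
  have hcn : ∀ m : ℕ, m ≠ 0 → ‖c m‖ ≤ 2 * ‖c 0‖ := fun m hm =>
    (norm_coeff_le_two_mul_re hc (fun z hz => (hre z (by simpa using hz)).le) hm).trans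
      (by gcongr; exact Complex.re_le_norm _)
  obtain ⟨m, rfl⟩ := Nat.exists_eq_succ_of_ne_zero hn
  rw [hb, Finset.Nat.sum_antidiagonal_eq_sum_range_succ (fun i j => c i * c j),
    Finset.sum_range_succ, Finset.sum_range_succ', hb0]
  have hmid : ‖∑ k ∈ Finset.range m, c (k + 1) * c (m + 1 - (k + 1))‖ ≤
      m * (2 * ‖c 0‖ * (2 * ‖c 0‖)) := by
    refine (norm_sum_le_of_le _ fun k hk => ?_).trans_eq
      (by rw [Finset.sum_const, Finset.card_range, nsmul_eq_mul])
    have := Finset.mem_range.1 hk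
    rw [norm_mul]
    exact mul_le_mul (hcn _ (by omega)) (hcn _ (by omega)) (norm_nonneg _) (by positivity)
  have hend := hcn (m + 1) (by omega)
  simp only [Nat.sub_zero, Nat.sub_self, Nat.succ_eq_add_one]
  refine (norm_add₃_le).trans ?_
  rw [norm_mul, norm_mul, Nat.cast_add, Nat.cast_one]
  nlinarith [norm_nonneg (c 0), mul_le_mul_of_nonneg_left hend (norm_nonneg (c 0))]

/-- Bohr phenomenon for maps into the slit plane `ℙ = ℂ ∖ (-∞, 0]`: if
`g z = ∑ bₙ zⁿ` is analytic in the unit disk and never takes a real value `≤ 0`,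
then `∑_{n≥1} |bₙ| |z|ⁿ ≤ |b₀| (= dist(|b₀|, ∂ℙ))` for `|z| ≤ 3 - 2√2`. -/
theorem bohr_slit_plane
    (g : ℂ → ℂ) (b : ℕ → ℂ)
    (hrep : ∀ z : ℂ, ‖z‖ < 1 → HasSum (fun n : ℕ => b n * z ^ n) (g z))
    (hslit : ∀ z : ℂ, ‖z‖ < 1 → ¬((g z).im = 0 ∧ (g z).re ≤ 0)) :
    ∀ z : ℂ, ‖z‖ ≤ 3 - 2 * Real.sqrt 2 →
      ∑' n : ℕ, ‖b (n + 1)‖ * ‖z‖ ^ (n + 1) ≤ ‖b 0‖ := by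
  intro z hz
  have hslit' : ∀ z : ℂ, ‖z‖ < 1 → g z ∈ Complex.slitPlane := fun w hw => by
    have := hslit w hw
    rw [Complex.mem_slitPlane_iff]
    by_contra! h
    exact this ⟨h.2, h.1⟩
  have hsqrt : Real.sqrt 2 ^ 2 = 2 := Real.sq_sqrt two_pos.le
  have hsqrt0 : 1 < Real.sqrt 2 := Real.lt_sqrt_of_sq_lt (by norm_num)
  have hz1 : ‖z‖ < 1 := by linarith
  have hbound : ∀ n : ℕ, ‖b (n + 1)‖ * ‖z‖ ^ (n + 1) ≤
      4 * ‖b 0‖ * (((n + 1 : ℕ) : ℝ) * ‖z‖ ^ (n + 1)) := fun n => by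
    have := norm_coeff_le_of_mem_slitPlane hrep hslit' n.succ_ne_zero
    calc _ ≤ (4 * ((n + 1 : ℕ) : ℝ) * ‖b 0‖) * ‖z‖ ^ (n + 1) := by gcongr
      _ = _ := by ring
  have hsum : HasSum (fun n : ℕ => ((n + 1 : ℕ) : ℝ) * ‖z‖ ^ (n + 1)) (‖z‖ / (1 - ‖z‖) ^ 2) := by
    have := hasSum_coe_mul_geometric_of_norm_lt_one (r := ‖z‖) (by simpa using hz1)
    rw [← hasSum_nat_add_iff' 1] at this
    simpa using this
  have hsum' := hsum.mul_left (4 * ‖b 0‖)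
  have hs : Summable fun n : ℕ => ‖b (n + 1)‖ * ‖z‖ ^ (n + 1) :=
    Summable.of_nonneg_of_le (fun n => by positivity) hbound hsum'.summable
  refine (hasSum_le hbound hs.hasSum hsum').trans ?_
  have hle : 4 * (‖z‖ / (1 - ‖z‖) ^ 2) ≤ 1 := by
    rw [← mul_div_assoc, div_le_one (by nlinarith)]
    nlinarith [norm_nonneg z]
  nlinarith [norm_nonneg (b 0)]
end

section
/- Let c_0 > 1 be real and let h(z) = Σ_{n=0}^∞ c_n z^n be analytic in the open unit disk 𝔻 with h(0) = c_0 and |h(z)| > 1 for all z ∈ 𝔻 (i.e., h maps 𝔻 into the exterior of the closed unit disk). Then for all z with |z| ≤ 1/3: (a) log(Σ_{n=0}^∞ |c_n z^n|) − log c_0 ≤ log c_0, i.e., Σ_{n=0}^∞ |c_n z^n| ≤ c_0²; and (b) if additionally c_0 ≤ 2, then Σ_{n=1}^∞ |c_n z^n| ≤ 2 c_0 log c_0. -/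
section

open Complex Metric Real

/-- **Carathéodory's coefficient estimate** for functions with nonnegative real part. -/
theorem norm_iteratedDeriv_zero_le_of_re_nonneg {g : ℂ → ℂ}
    (hg : DifferentiableOn ℂ g (ball 0 1)) (hre : ∀ z ∈ ball (0 : ℂ) 1, 0 ≤ (g z).re)
    {n : ℕ} (hn : n ≠ 0) :
    ‖iteratedDeriv n g 0‖ ≤ n.factorial * (2 * (g 0).re) := by
  have main : ∀ r ∈ Set.Ioo (0 : ℝ) 1,
      r ^ n * ‖iteratedDeriv n g 0‖ ≤ n.factorial * (2 * (g 0).re) := by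
    rintro r ⟨hr0, hr1⟩
    have hsub : closedBall (0 : ℂ) r ⊆ ball 0 1 := closedBall_subset_ball hr1
    have hgr : DifferentiableOn ℂ g (closedBall 0 r) := hg.mono hsub
    have hcont : ContinuousOn g (sphere 0 r) := hgr.continuousOn.mono sphere_subset_closedBall
    have hne : ∀ z ∈ sphere (0 : ℂ) r, z ≠ 0 := fun z hz => ne_of_mem_sphere hz hr0.ne'
    have hdc : ∀ f : ℂ → ℂ, DifferentiableOn ℂ f (closedBall 0 r) →
        circleAverage f 0 r = f 0 := fun f hf => by
      refine DiffContOnCl.circleAverage ?_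
      rw [abs_of_pos hr0]
      exact (hf.mono closure_ball_subset_closedBall).diffContOnCl
    have hint : ∀ f : ℂ → ℂ, ContinuousOn f (sphere 0 r) → CircleIntegrable f 0 r :=
      fun f hf => hf.circleIntegrable hr0.le
    have hf₁ : ContinuousOn (fun z => (z ^ n)⁻¹ * g z) (sphere 0 r) :=
      ((continuousOn_pow n).inv₀ fun z hz => pow_ne_zero n (hne z hz)).mul hcont
    have hf₂ : ContinuousOn (fun z => z ^ n * g z) (sphere 0 r) :=
      (continuousOn_pow n).mul hcont
    have hf₃ : ContinuousOn (fun z => ((r : ℂ) ^ (2 * n))⁻¹ * starRingEnd ℂ (z ^ n * g z))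
        (sphere 0 r) :=
      continuousOn_const.mul (continuous_conj.comp_continuousOn hf₂)
    have h₁ : circleAverage (fun z => (z ^ n)⁻¹ * g z) 0 r
        = (n.factorial : ℂ)⁻¹ * iteratedDeriv n g 0 := by
      rw [circleAverage_eq_circleIntegral hr0.ne']
      have := hgr.circleIntegral_one_div_sub_center_pow_smul hr0 n
      have h2 : ∀ z : ℂ, (z - 0)⁻¹ • ((z ^ n)⁻¹ * g z) = (1 / (z - 0) ^ (n + 1)) • g z := by
        intro z
        simp [pow_succ, mul_comm, mul_left_comm]
      simp_rw [h2, this, smul_smul]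
      rw [smul_eq_mul]
      congr 1
      field_simp [two_pi_I_ne_zero]
    have h₂ : circleAverage
        (fun z => ((r : ℂ) ^ (2 * n))⁻¹ * starRingEnd ℂ (z ^ n * g z)) 0 r = 0 := by
      have h3 := (conjCLE : ℂ →L[ℝ] ℂ).circleAverage_comp_comm (hint _ hf₂)
      rw [hdc (fun z => z ^ n * g z) (by fun_prop)] at h3
      have h4 := circleAverage_fun_smul (a := ((r : ℂ) ^ (2 * n))⁻¹)
        (f := (conjCLE : ℂ →L[ℝ] ℂ) ∘ (fun z => z ^ n * g z)) (c := 0) (R := r)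
      rw [h3] at h4
      simpa [hn] using h4
    have h₃ : circleAverage (fun z => (g z).re) 0 r = (g 0).re := by
      have := reCLM.circleAverage_comp_comm (hint _ hcont)
      rw [hdc g hgr] at this
      exact this
    have h₄ : (n.factorial : ℂ)⁻¹ * iteratedDeriv n g 0 = circleAverage (fun z =>
        (z ^ n)⁻¹ * g z + ((r : ℂ) ^ (2 * n))⁻¹ * starRingEnd ℂ (z ^ n * g z)) 0 r := by
      rw [circleAverage_fun_add (hint _ hf₁) (hint _ hf₃), h₁, h₂, add_zero]
    have h₅ : ∀ z ∈ sphere (0 : ℂ) r,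
        ‖(z ^ n)⁻¹ * g z + ((r : ℂ) ^ (2 * n))⁻¹ * starRingEnd ℂ (z ^ n * g z)‖
          = (r ^ n)⁻¹ * 2 * (g z).re := by
      intro z hz
      have hzr : ‖z‖ = r := by simpa using hz
      have hz0 := hne z hz
      have hrz : (r : ℂ) ^ (2 * n) = z ^ n * starRingEnd ℂ z ^ n := by
        rw [← mul_pow, mul_conj, normSq_eq_norm_sq, hzr, pow_mul]; push_cast; rfl
      have hcz : starRingEnd ℂ z ≠ 0 := by simpa using hz0
      have : (z ^ n)⁻¹ * g z + ((r : ℂ) ^ (2 * n))⁻¹ * starRingEnd ℂ (z ^ n * g z)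
          = (z ^ n)⁻¹ * ((2 * (g z).re : ℝ) : ℂ) := by
        rw [← add_conj, hrz, map_mul, map_pow]
        field_simp
      rw [this, norm_mul, norm_inv, norm_pow, hzr, Complex.norm_real, Real.norm_eq_abs,
        abs_of_nonneg, mul_assoc]
      exact mul_nonneg zero_le_two (hre z (hsub (sphere_subset_closedBall hz)))
    have h₆ : ‖(n.factorial : ℂ)⁻¹ * iteratedDeriv n g 0‖ ≤ (r ^ n)⁻¹ * 2 * (g 0).re := by
      rw [h₄, ← h₃, ← smul_eq_mul (a := (r ^ n)⁻¹ * 2), ← circleAverage_fun_smul,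
        Real.circleAverage, Real.circleAverage, norm_smul, norm_inv, Real.norm_eq_abs,
        abs_of_pos two_pi_pos, smul_eq_mul]
      gcongr
      refine (intervalIntegral.norm_integral_le_integral_norm two_pi_pos.le).trans_eq ?_
      exact intervalIntegral.integral_congr fun θ _ => h₅ _ (circleMap_mem_sphere 0 hr0.le θ)
    rw [norm_mul, norm_inv, Complex.norm_natCast] at h₆
    have hf : (0 : ℝ) < n.factorial := by positivity
    have hrn : 0 < r ^ n := by positivity
    field_simp at h₆
    linarith
  have hlim : Filter.Tendsto (fun r : ℝ => r ^ n * ‖iteratedDeriv n g 0‖)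
      (nhdsWithin 1 (Set.Iio 1)) (nhds (1 ^ n * ‖iteratedDeriv n g 0‖)) :=
    (Continuous.tendsto (by fun_prop) _).mono_left nhdsWithin_le_nhds
  rw [one_pow, one_mul] at hlim
  exact le_of_tendsto hlim (Filter.mem_of_superset (Ioo_mem_nhdsLT one_pos) main)

/-- A zero-free holomorphic function on the unit disk has a holomorphic logarithm there, with
prescribed value at the centre. -/
theorem exists_log_on_ball {h : ℂ → ℂ} (hh : DifferentiableOn ℂ h (ball 0 1))
    (hne : ∀ z ∈ ball (0 : ℂ) 1, h z ≠ 0) {a : ℂ} (ha : exp a = h 0) :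
    ∃ g : ℂ → ℂ, g 0 = a ∧ (∀ z ∈ ball (0 : ℂ) 1, HasDerivAt g (deriv h z / h z) z) ∧
      ∀ z ∈ ball (0 : ℂ) 1, exp (g z) = h z := by
  have hq : DifferentiableOn ℂ (fun z => deriv h z / h z) (ball 0 1) :=
    (hh.deriv isOpen_ball).div hh hne
  obtain ⟨g, hg0, hg⟩ := hq.isExactOn_ball.with_val_at 0 a
  refine ⟨g, hg0, hg, fun z hz => ?_⟩
  have hd : ∀ z ∈ ball (0 : ℂ) 1, HasDerivAt (fun z => h z * exp (-g z)) 0 z := by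
    intro z hz
    have h1 := (hh.differentiableAt (isOpen_ball.mem_nhds hz)).hasDerivAt.mul (hg z hz).neg.cexp
    convert! h1 using 1
    field_simp [hne z hz]
    ring
  have hc := isOpen_ball.is_const_of_deriv_eq_zero (convex_ball (0 : ℂ) 1).isPreconnected
    (fun z hz => (hd z hz).differentiableAt.differentiableWithinAt)
    (fun z hz => (hd z hz).deriv) hz (mem_ball_self one_pos)
  simp only [hg0, ← ha, ← Complex.exp_add, add_neg_cancel, Complex.exp_zero] at hc
  rw [Complex.exp_neg, mul_inv_eq_one₀ (Complex.exp_ne_zero _)] at hc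
  exact hc.symm

/-- Majorant principle: a nonnegative sequence whose generating function `s` satisfies
`s' ≤ K (1 - r)⁻² s` coefficientwise has `s r ≤ s 0 * exp (K r / (1 - r))`. -/
theorem sum_mul_pow_le_mul_exp {α : ℕ → ℝ} {K : ℝ} (hK : 0 ≤ K) (hα : ∀ n, 0 ≤ α n)
    (hrec : ∀ n, (n + 1) * α (n + 1) ≤ ∑ i ∈ Finset.range (n + 1), K * (i + 1) * α (n - i))
    {r : ℝ} (hr0 : 0 ≤ r) (hr1 : r < 1) (N : ℕ) :
    ∑ n ∈ Finset.range (N + 1), α n * r ^ n ≤ α 0 * Real.exp (K * (r / (1 - r))) := by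
  set s : ℝ → ℝ := fun x => ∑ n ∈ Finset.range (N + 1), α n * x ^ n with hs
  set s' : ℝ → ℝ := fun x => ∑ n ∈ Finset.range N, (n + 1) * α (n + 1) * x ^ n with hs'
  have hder : ∀ x, HasDerivAt s (s' x) x := by
    intro x
    have h1 : HasDerivAt s (∑ n ∈ Finset.range (N + 1), α n * (n * x ^ (n - 1))) x :=
      HasDerivAt.fun_sum fun n _ => (hasDerivAt_pow n x).const_mul (α n)
    convert! h1 using 1
    rw [Finset.sum_range_succ']
    simp only [hs', Nat.cast_zero, zero_mul, mul_zero, add_zero, Nat.add_sub_cancel]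
    refine Finset.sum_congr rfl fun n _ => ?_
    push_cast; ring
  have hle : ∀ x, 0 ≤ x → x < 1 → s' x ≤ K / (1 - x) ^ 2 * s x := by
    intro x hx0 hx1
    have hgeo : ∀ M, ∑ i ∈ Finset.range M, ((i : ℝ) + 1) * x ^ i ≤ 1 / (1 - x) ^ 2 := by
      intro M
      have := hasSum_choose_mul_geometric_of_norm_lt_one 1
        (r := x) (by rwa [Real.norm_eq_abs, abs_of_nonneg hx0])
      simp only [Nat.choose_one_right, Nat.cast_add, Nat.cast_one, Nat.reduceAdd] at this
      exact sum_le_hasSum _ (fun i _ => by positivity) this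
    calc s' x ≤ ∑ n ∈ Finset.range N, ∑ i ∈ Finset.range (n + 1),
          (K * (i + 1) * x ^ i) * (α (n - i) * x ^ (n - i)) := by
          refine Finset.sum_le_sum fun n _ => ?_
          refine (mul_le_mul_of_nonneg_right (hrec n) (pow_nonneg hx0 n)).trans_eq ?_
          rw [Finset.sum_mul]
          refine Finset.sum_congr rfl fun i hi => ?_
          rw [← Nat.add_sub_of_le (Finset.mem_range_succ_iff.mp hi), pow_add,
            Nat.add_sub_cancel_left]
          ring
      _ = ∑ i ∈ Finset.range N, ∑ j ∈ Finset.range (N - i),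
          (K * (i + 1) * x ^ i) * (α j * x ^ j) :=
          Finset.sum_range_diag_flip N fun i j => (K * (i + 1) * x ^ i) * (α j * x ^ j)
      _ ≤ ∑ i ∈ Finset.range N, (K * (i + 1) * x ^ i) * s x := by
          refine Finset.sum_le_sum fun i _ => ?_
          rw [← Finset.mul_sum]
          refine mul_le_mul_of_nonneg_left ?_ (by positivity)
          exact Finset.sum_le_sum_of_subset_of_nonneg
            (Finset.range_subset_range.mpr (by omega))
            fun j _ _ => mul_nonneg (hα j) (pow_nonneg hx0 j)
      _ = K * (∑ i ∈ Finset.range N, ((i : ℝ) + 1) * x ^ i) * s x := by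
          simp only [mul_assoc K]
          rw [← Finset.mul_sum, ← Finset.sum_mul]
      _ ≤ K * (1 / (1 - x) ^ 2) * s x := by
          have : 0 ≤ s x := Finset.sum_nonneg fun j _ => mul_nonneg (hα j) (pow_nonneg hx0 j)
          gcongr
          exact hgeo N
      _ = K / (1 - x) ^ 2 * s x := by ring
  have hF : ∀ x, x < 1 → HasDerivAt (fun x => s x * Real.exp (-(K * (x / (1 - x)))))
      ((s' x - K / (1 - x) ^ 2 * s x) * Real.exp (-(K * (x / (1 - x))))) x := by
    intro x hx
    have hx' : 1 - x ≠ 0 := by linarith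
    have h1 : HasDerivAt (fun y : ℝ => y / (1 - y)) (1 / (1 - x) ^ 2) x := by
      convert! (hasDerivAt_id x).fun_div ((hasDerivAt_id x).const_sub 1) hx' using 1
      simp
    convert! (hder x).mul (h1.const_mul K).fun_neg.exp using 1
    ring
  have hanti : AntitoneOn (fun x => s x * Real.exp (-(K * (x / (1 - x))))) (Set.Ico 0 1) := by
    refine antitoneOn_of_deriv_nonpos (convex_Ico 0 1)
      (fun x hx => (hF x hx.2).continuousAt.continuousWithinAt)
      (fun x hx => ?_) (fun x hx => ?_) <;> rw [interior_Ico] at hx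
    · exact (hF x hx.2).differentiableAt.differentiableWithinAt
    · rw [(hF x hx.2).deriv]
      exact mul_nonpos_of_nonpos_of_nonneg (sub_nonpos.mpr (hle x hx.1.le hx.2))
        (Real.exp_pos _).le
  have hfin := hanti ⟨le_rfl, one_pos⟩ ⟨hr0, hr1⟩ hr0
  have hs0 : s 0 = α 0 := by simp [hs, Finset.sum_range_succ']
  simp only [hs0, zero_div, mul_zero, neg_zero, Real.exp_zero, mul_one, Real.exp_neg] at hfin
  rwa [← div_eq_mul_inv, div_le_iff₀ (Real.exp_pos _)] at hfin

/-- The sum of a power series converging on the unit disk is holomorphic there, and the power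
series is its Taylor series. -/
theorem differentiableOn_and_iteratedDeriv_of_hasSum {h : ℂ → ℂ} {c : ℕ → ℂ}
    (hrep : ∀ z : ℂ, ‖z‖ < 1 → HasSum (fun n : ℕ => c n * z ^ n) (h z)) :
    DifferentiableOn ℂ h (ball 0 1) ∧ ∀ n, iteratedDeriv n h 0 = n.factorial * c n := by
  have hp : HasFPowerSeriesOnBall h (FormalMultilinearSeries.ofScalars ℂ c) 0 1 := by
    refine ⟨?_, one_pos, fun {y} hy => ?_⟩
    · refine le_of_forall_lt_imp_le_of_dense fun r hr => ?_
      lift r to NNReal using hr.ne_top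
      refine FormalMultilinearSeries.le_radius_of_summable _ ?_
      have hr' : ‖((r : ℝ) : ℂ)‖ < 1 := by simpa using hr
      simpa using (hrep _ hr').summable.norm
    · have hy' : ‖y‖ < 1 := by
        simpa [edist_zero_right, enorm_eq_nnnorm, ← NNReal.coe_lt_one] using hy
      simpa [mul_comm] using hrep y hy'
  refine ⟨?_, fun n => ?_⟩
  · have := hp.differentiableOn
    rwa [← ENNReal.coe_one, Metric.eball_coe, NNReal.coe_one] at this
  · have := hp.factorial_smul 1 n
    rw [iteratedFDeriv_apply_eq_iteratedDeriv_mul_prod, Finset.prod_const_one, one_smul] at this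
    rw [← this]
    simp

/-- Recursive bound for the Taylor coefficients of a function mapping the unit disk into the
exterior of the closed unit disk, with positive value at the centre. -/
theorem succ_mul_norm_le_sum_of_one_lt_norm {h : ℂ → ℂ} {c : ℕ → ℂ} {c₀ : ℝ} (hc₀ : 1 < c₀)
    (hrep : ∀ z : ℂ, ‖z‖ < 1 → HasSum (fun n : ℕ => c n * z ^ n) (h z))
    (h0 : c 0 = (c₀ : ℂ)) (hout : ∀ z : ℂ, ‖z‖ < 1 → 1 < ‖h z‖) (n : ℕ) :
    (n + 1) * ‖c (n + 1)‖
      ≤ ∑ i ∈ Finset.range (n + 1), 2 * Real.log c₀ * (i + 1) * ‖c (n - i)‖ := by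
  obtain ⟨hd, hco⟩ := differentiableOn_and_iteratedDeriv_of_hasSum hrep
  have hh0 : h 0 = c₀ := by simpa [h0] using hco 0
  have hne : ∀ z ∈ ball (0 : ℂ) 1, h z ≠ 0 := fun z hz =>
    norm_pos_iff.mp (one_pos.trans (hout z (by simpa using hz)))
  obtain ⟨g, hg0, hg, hexp⟩ := exists_log_on_ball hd hne (a := (Real.log c₀ : ℝ)) (by
    rw [← ofReal_exp, Real.exp_log (by linarith), hh0])
  have hgd : DifferentiableOn ℂ g (ball 0 1) := fun z hz =>
    (hg z hz).differentiableAt.differentiableWithinAt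
  have hre : ∀ z ∈ ball (0 : ℂ) 1, 0 ≤ (g z).re := by
    intro z hz
    have := hout z (by simpa using hz)
    rw [← hexp z hz, norm_exp, Real.one_lt_exp_iff] at this
    exact this.le
  have hb : ball (0 : ℂ) 1 ∈ nhds 0 := ball_mem_nhds 0 one_pos
  have hderiv : deriv h =ᶠ[nhds 0] deriv g * h := by
    filter_upwards [hb] with z hz
    rw [Pi.mul_apply, (hg z hz).deriv, div_mul_cancel₀ _ (hne z hz)]
  have hmul := hderiv.iteratedDeriv_eq n
  rw [← iteratedDeriv_succ', iteratedDeriv_mul ((hgd.deriv isOpen_ball).analyticAt hb).contDiffAt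
    (hd.analyticAt hb).contDiffAt, hco] at hmul
  have hsum : ((n : ℂ) + 1) * c (n + 1) = ∑ i ∈ Finset.range (n + 1),
      (i.factorial : ℂ)⁻¹ * iteratedDeriv (i + 1) g 0 * c (n - i) := by
    have hn : (n.factorial : ℂ) ≠ 0 := mod_cast n.factorial_ne_zero
    apply mul_left_cancel₀ hn
    rw [Nat.factorial_succ] at hmul
    push_cast at hmul
    rw [← mul_assoc, mul_comm (n.factorial : ℂ), hmul, Finset.mul_sum]
    refine Finset.sum_congr rfl fun i hi => ?_
    have hi' := Finset.mem_range_succ_iff.mp hi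
    rw [hco, ← iteratedDeriv_succ', ← Nat.choose_mul_factorial_mul_factorial hi']
    have : (i.factorial : ℂ) ≠ 0 := mod_cast i.factorial_ne_zero
    push_cast
    field_simp
  have hnorm := congrArg norm hsum
  rw [norm_mul, ← Nat.cast_succ, Complex.norm_natCast, Nat.cast_succ] at hnorm
  rw [hnorm]
  refine (norm_sum_le _ _).trans (Finset.sum_le_sum fun i _ => ?_)
  rw [norm_mul, norm_mul, norm_inv, Complex.norm_natCast]
  refine mul_le_mul_of_nonneg_right ?_ (norm_nonneg _)
  have hcar := norm_iteratedDeriv_zero_le_of_re_nonneg hgd hre i.succ_ne_zero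
  rw [hg0, ofReal_re, Nat.succ_eq_add_one, Nat.factorial_succ] at hcar
  have hi : (0 : ℝ) < i.factorial := by positivity
  rw [inv_mul_le_iff₀ hi]
  push_cast at hcar
  linarith

end

/-- Bohr phenomenon in the hyperbolic metric for maps into the exterior of the
closed unit disk: let `c₀ > 1` and `h z = ∑ cₙ zⁿ` be analytic in the unit disk
with `h 0 = c₀` and `|h| > 1` there. Then for `|z| ≤ 1/3`:
(a) `∑_{n≥0} |cₙ zⁿ| ≤ c₀²` (equivalently `log ∑ - log c₀ ≤ log c₀`), and
(b) if moreover `c₀ ≤ 2`, then `∑_{n≥1} |cₙ zⁿ| ≤ 2 c₀ log c₀`. -/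
theorem bohr_hyperbolic_exterior_disk
    (h : ℂ → ℂ) (c : ℕ → ℂ) (c₀ : ℝ) (hc₀ : 1 < c₀)
    (hrep : ∀ z : ℂ, ‖z‖ < 1 → HasSum (fun n : ℕ => c n * z ^ n) (h z))
    (h0 : c 0 = (c₀ : ℂ))
    (hout : ∀ z : ℂ, ‖z‖ < 1 → 1 < ‖h z‖) :
    ∀ z : ℂ, ‖z‖ ≤ 1 / 3 →
      (∑' n : ℕ, ‖c n‖ * ‖z‖ ^ n ≤ c₀ ^ 2) ∧
      (c₀ ≤ 2 → ∑' n : ℕ, ‖c (n + 1)‖ * ‖z‖ ^ (n + 1) ≤ 2 * c₀ * Real.log c₀) := by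
  intro z hz
  have hlog : 0 ≤ Real.log c₀ := Real.log_nonneg hc₀.le
  have hpos : 0 < c₀ := one_pos.trans hc₀
  have hpartial : ∀ N, ∑ n ∈ Finset.range (N + 1), ‖c n‖ * ‖z‖ ^ n ≤ c₀ ^ 2 := by
    intro N
    refine (sum_mul_pow_le_mul_exp (by positivity) (fun n => norm_nonneg (c n))
      (succ_mul_norm_le_sum_of_one_lt_norm hc₀ hrep h0 hout) (norm_nonneg z)
      (by linarith) N).trans ?_
    have hfrac : ‖z‖ / (1 - ‖z‖) ≤ 1 / 2 := by
      rw [div_le_iff₀ (by linarith)]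
      linarith
    rw [h0, Complex.norm_real, Real.norm_eq_abs, abs_of_pos hpos, sq]
    refine mul_le_mul_of_nonneg_left ?_ hpos.le
    rw [← Real.le_log_iff_exp_le hpos]
    nlinarith
  refine ⟨Real.tsum_le_of_sum_range_le (fun n => by positivity) fun N => ?_, fun hc₂ =>
    Real.tsum_le_of_sum_range_le (fun n => by positivity) fun N => ?_⟩
  · refine le_trans ?_ (hpartial N)
    rw [Finset.sum_range_succ]
    exact le_add_of_nonneg_right (by positivity)
  · have hN := hpartial N
    rw [Finset.sum_range_succ', h0, Complex.norm_real, Real.norm_eq_abs, abs_of_pos hpos,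
      pow_zero, mul_one] at hN
    have hinv := Real.one_sub_inv_le_log_of_pos hpos
    have hlin : c₀ - 1 ≤ c₀ * Real.log c₀ := by
      have := mul_le_mul_of_nonneg_left hinv hpos.le
      rwa [mul_sub, mul_one, mul_inv_cancel₀ hpos.ne'] at this
    nlinarith
end
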